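/- arXiv:2203.15848 — 10 statements merged into one kernel-verified Lean document; each statement's English description precedes it below -/
import Mathlib

section
/- Suppose M, Dx, Dy, L, W, Nx, Ny satisfy the SBP property and M is invertible. Let a_x, a_y ∈ ℝ, u ∈ ℝⁿ, and set the linear flux Fx = a_x·u, Fy = a_y·u. Let fnum ∈ ℝᵐ be arbitrary and take the DG correction matrix C = M⁻¹·Lᵀ·W, so that u̇ = −(Dx·Fx + Dy·Fy) − M⁻¹·Lᵀ·W·(fnum − Nx·L·Fx − Ny·L·Fy). Then the energy rate in the norm induced by M satisfies the identity 2·uᵀ·M·u̇ = uᵀ·Lᵀ·W·(Nx·L·Fx + Ny·L·Fy − 2·fnum). -/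
open Matrix

/-- The quadratic form of `M * D` is half that of the boundary form `B` whenever
`M * D + Dᵀ * M = B` with `M` symmetric. -/
theorem two_mul_dotProduct_mulVec_of_add_transpose_eq {ι : Type*} [Fintype ι]
    {M D B : Matrix ι ι ℝ} (hM : M.IsSymm) (h : M * D + Dᵀ * M = B) (u : ι → ℝ) :
    2 * (u ⬝ᵥ (M * D).mulVec u) = u ⬝ᵥ B.mulVec u := by
  have ht : (M * D)ᵀ = Dᵀ * M := by rw [transpose_mul, hM.eq]
  rw [← h, add_mulVec, dotProduct_add, ← ht, mulVec_transpose, dotProduct_comm u (u ᵥ* _),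
    ← dotProduct_mulVec, two_mul]

/-- Energy rate identity for the DG correction matrix `C = M⁻¹ Lᵀ W`
under the two-dimensional SBP property. -/
theorem fr_dg_energy_rate {n m : ℕ}
    (M Dx Dy : Matrix (Fin n) (Fin n) ℝ)
    (L : Matrix (Fin m) (Fin n) ℝ)
    (W Nx Ny : Matrix (Fin m) (Fin m) ℝ)
    (hM : M.IsSymm) (hW : W.IsDiag) (hNx : Nx.IsDiag) (hNy : Ny.IsDiag)
    (hSBPx : M * Dx + Dxᵀ * M = Lᵀ * W * Nx * L)
    (hSBPy : M * Dy + Dyᵀ * M = Lᵀ * W * Ny * L)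
    (hMinv : IsUnit M.det)
    (ax ay : ℝ) (u : Fin n → ℝ) (fnum : Fin m → ℝ)
    (Fx Fy : Fin n → ℝ) (hFx : Fx = ax • u) (hFy : Fy = ay • u)
    (udot : Fin n → ℝ)
    (hudot : udot = -(Dx.mulVec Fx + Dy.mulVec Fy) -
      (M⁻¹ * Lᵀ * W).mulVec
        (fnum - Nx.mulVec (L.mulVec Fx) - Ny.mulVec (L.mulVec Fy))) :
    2 * (u ⬝ᵥ M.mulVec udot) =
      u ⬝ᵥ (Lᵀ * W).mulVec
        (Nx.mulVec (L.mulVec Fx) + Ny.mulVec (L.mulVec Fy) - (2 : ℝ) • fnum) := by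
  have hx := two_mul_dotProduct_mulVec_of_add_transpose_eq hM hSBPx u
  have hy := two_mul_dotProduct_mulVec_of_add_transpose_eq hM hSBPy u
  have hC : M * (M⁻¹ * Lᵀ * W) = Lᵀ * W := by
    rw [Matrix.mul_assoc M⁻¹, mul_nonsing_inv_cancel_left _ _ hMinv]
  subst hFx hFy hudot
  simp only [mulVec_sub, mulVec_neg, mulVec_add, mulVec_smul, mulVec_mulVec, hC,
    dotProduct_sub, dotProduct_neg, dotProduct_add, dotProduct_smul, smul_eq_mul,
    ← Matrix.mul_assoc] at hx hy ⊢
  linear_combination -ax * hx - ay * hy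
end

section
/- Let u⁻, u⁺, w, s, κ ∈ ℝ with w ≥ 0 and 0 ≤ κ ≤ 1. Define the upwinded numerical interface fluxes fnum⁺ = (1/2)·s·(u⁺ + u⁻) − (1/2)·κ·|s|·(u⁻ − u⁺) and fnum⁻ = −(1/2)·s·(u⁻ + u⁺) − (1/2)·κ·|s|·(u⁺ − u⁻). Then the combined interface energy contribution satisfies u⁻·w·(−s·u⁻ − 2·fnum⁻) + u⁺·w·(s·u⁺ − 2·fnum⁺) = −κ·|s|·w·(u⁻ − u⁺)², and in particular this quantity is ≤ 0. -/
/-- The combined interface energy contribution for the upwinded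
numerical flux equals `−κ|s|w(u⁻−u⁺)²` and is nonpositive. -/
theorem interface_energy_contribution
    (um up w s κ : ℝ) (hw : 0 ≤ w) (hκ0 : 0 ≤ κ) (hκ1 : κ ≤ 1)
    (fnump fnumm : ℝ)
    (hfp : fnump = (1/2) * s * (up + um) - (1/2) * κ * |s| * (um - up))
    (hfm : fnumm = -(1/2) * s * (um + up) - (1/2) * κ * |s| * (up - um)) :
    um * w * (-s * um - 2 * fnumm) + up * w * (s * up - 2 * fnump) =
      -κ * |s| * w * (um - up) ^ 2 ∧
    um * w * (-s * um - 2 * fnumm) + up * w * (s * up - 2 * fnump) ≤ 0 := by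
  have h : um * w * (-s * um - 2 * fnumm) + up * w * (s * up - 2 * fnump) =
      -κ * |s| * w * (um - up) ^ 2 := by
    rw [hfp, hfm]
    ring
  refine ⟨h, ?_⟩
  have hnonneg : 0 ≤ κ * |s| * w * (um - up) ^ 2 := by positivity
  rw [h]
  linarith
end

section
/- Suppose M, Dx, Dy, L, W, Nx, Ny satisfy the SBP property. Let Q be a symmetric n×n matrix with Q·Dx + Dxᵀ·Q = 0 and Q·Dy + Dyᵀ·Q = 0, and suppose M + Q is invertible. Let a_x, a_y ∈ ℝ, u ∈ ℝⁿ, set the linear flux Fx = a_x·u, Fy = a_y·u, let fnum ∈ ℝᵐ be arbitrary, and take the correction matrix C = (M+Q)⁻¹·Lᵀ·W, so that u̇ = −(Dx·Fx + Dy·Fy) − (M+Q)⁻¹·Lᵀ·W·(fnum − Nx·L·Fx − Ny·L·Fy). Then the energy rate in the norm induced by M + Q satisfies 2·uᵀ·(M+Q)·u̇ = uᵀ·Lᵀ·W·(Nx·L·Fx + Ny·L·Fy − 2·fnum). -/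
open Matrix

/-- The quadratic form of `S * D` is half that of its symmetrization `S * D + Dᵀ * S`. -/
theorem Matrix.IsSymm.two_mul_dotProduct_mul_mulVec {ι R : Type*} [Fintype ι] [CommRing R]
    {S D B : Matrix ι ι R} (hS : S.IsSymm) (h : S * D + Dᵀ * S = B) (u : ι → R) :
    2 * (u ⬝ᵥ (S * D) *ᵥ u) = u ⬝ᵥ B *ᵥ u := by
  have ht : u ⬝ᵥ (Dᵀ * S) *ᵥ u = u ⬝ᵥ (S * D) *ᵥ u := by
    rw [dotProduct_comm, ← vecMul_transpose, ← dotProduct_mulVec, transpose_mul,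
      transpose_transpose, hS.eq]
  rw [← h, add_mulVec, dotProduct_add, ht, two_mul]

/-- Energy rate identity in the norm induced by `M + Q` for the
extended-range correction matrix `C = (M+Q)⁻¹ Lᵀ W`, where `Q` is symmetric and
skew-compatible with the differentiation matrices. -/
theorem fr_extended_energy_rate {n m : ℕ}
    (M Dx Dy : Matrix (Fin n) (Fin n) ℝ)
    (L : Matrix (Fin m) (Fin n) ℝ)
    (W Nx Ny : Matrix (Fin m) (Fin m) ℝ)
    (hM : M.IsSymm) (hW : W.IsDiag) (hNx : Nx.IsDiag) (hNy : Ny.IsDiag)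
    (hSBPx : M * Dx + Dxᵀ * M = Lᵀ * W * Nx * L)
    (hSBPy : M * Dy + Dyᵀ * M = Lᵀ * W * Ny * L)
    (Q : Matrix (Fin n) (Fin n) ℝ) (hQ : Q.IsSymm)
    (hQDx : Q * Dx + Dxᵀ * Q = 0)
    (hQDy : Q * Dy + Dyᵀ * Q = 0)
    (hMQinv : IsUnit (M + Q).det)
    (ax ay : ℝ) (u : Fin n → ℝ) (fnum : Fin m → ℝ)
    (Fx Fy : Fin n → ℝ) (hFx : Fx = ax • u) (hFy : Fy = ay • u)
    (udot : Fin n → ℝ)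
    (hudot : udot = -(Dx.mulVec Fx + Dy.mulVec Fy) -
      ((M + Q)⁻¹ * Lᵀ * W).mulVec
        (fnum - Nx.mulVec (L.mulVec Fx) - Ny.mulVec (L.mulVec Fy))) :
    2 * (u ⬝ᵥ (M + Q).mulVec udot) =
      u ⬝ᵥ (Lᵀ * W).mulVec
        (Nx.mulVec (L.mulVec Fx) + Ny.mulVec (L.mulVec Fy) - (2 : ℝ) • fnum) := by
  have hP : (M + Q).IsSymm := hM.add hQ
  have hx : (M + Q) * Dx + Dxᵀ * (M + Q) = Lᵀ * W * Nx * L := by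
    rw [add_mul, mul_add, add_add_add_comm, hSBPx, hQDx, add_zero]
  have hy : (M + Q) * Dy + Dyᵀ * (M + Q) = Lᵀ * W * Ny * L := by
    rw [add_mul, mul_add, add_add_add_comm, hSBPy, hQDy, add_zero]
  have ex := hP.two_mul_dotProduct_mul_mulVec hx u
  have ey := hP.two_mul_dotProduct_mul_mulVec hy u
  have hC : (M + Q) * ((M + Q)⁻¹ * Lᵀ * W) = Lᵀ * W := by
    rw [Matrix.mul_assoc (M + Q)⁻¹, mul_nonsing_inv_cancel_left _ _ hMQinv]
  subst hudot hFx hFy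
  rw [mulVec_sub, mulVec_mulVec, hC]
  simp only [mulVec_sub, mulVec_add, mulVec_neg, mulVec_smul, mulVec_mulVec, dotProduct_sub,
    dotProduct_add, dotProduct_neg, dotProduct_smul, smul_eq_mul, ← Matrix.mul_assoc]
  linear_combination -ax * ex - ay * ey
end

section
/- Suppose M, Dx, Dy, L, W, Nx, Ny satisfy the SBP property. Let Q be any symmetric n×n matrix with M + Q invertible. Let a_x, a_y ∈ ℝ, u ∈ ℝⁿ, set the linear flux Fx = a_x·u, Fy = a_y·u, let fnum ∈ ℝᵐ be arbitrary, and take C = (M+Q)⁻¹·Lᵀ·W, so that u̇ = −(Dx·Fx + Dy·Fy) − (M+Q)⁻¹·Lᵀ·W·(fnum − Nx·L·Fx − Ny·L·Fy). Then 2·uᵀ·(M+Q)·u̇ = −2·a_x·uᵀ·Q·Dx·u − 2·a_y·uᵀ·Q·Dy·u + uᵀ·Lᵀ·W·(Nx·L·Fx + Ny·L·Fy − 2·fnum). -/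
open Matrix

/-- Discrete integration by parts: under the summation-by-parts property, the energy form of a
differentiation matrix is half of its boundary form. -/
theorem two_mul_dotProduct_mulVec_of_sbp {ι R : Type*} [Fintype ι] [CommRing R]
    {M D B : Matrix ι ι R} (hM : M.IsSymm) (h : M * D + Dᵀ * M = B) (u : ι → R) :
    2 * (u ⬝ᵥ (M * D) *ᵥ u) = u ⬝ᵥ B *ᵥ u := by
  have ht : u ⬝ᵥ (Dᵀ * M) *ᵥ u = u ⬝ᵥ (M * D) *ᵥ u := by
    rw [← dotProduct_transpose_mulVec, transpose_mul, transpose_transpose, hM.eq]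
  rw [← h, add_mulVec, dotProduct_add, ht, two_mul]

/-- General energy rate identity in the norm induced by `M + Q` for
`C = (M+Q)⁻¹ Lᵀ W`, with `Q` symmetric but not necessarily skew-compatible, so
volume terms `−2aₓ uᵀQDₓu − 2a_y uᵀQD_yu` remain. -/
theorem fr_extended_energy_rate_general {n m : ℕ}
    (M Dx Dy : Matrix (Fin n) (Fin n) ℝ)
    (L : Matrix (Fin m) (Fin n) ℝ)
    (W Nx Ny : Matrix (Fin m) (Fin m) ℝ)
    (hM : M.IsSymm) (hW : W.IsDiag) (hNx : Nx.IsDiag) (hNy : Ny.IsDiag)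
    (hSBPx : M * Dx + Dxᵀ * M = Lᵀ * W * Nx * L)
    (hSBPy : M * Dy + Dyᵀ * M = Lᵀ * W * Ny * L)
    (Q : Matrix (Fin n) (Fin n) ℝ) (hQ : Q.IsSymm)
    (hMQinv : IsUnit (M + Q).det)
    (ax ay : ℝ) (u : Fin n → ℝ) (fnum : Fin m → ℝ)
    (Fx Fy : Fin n → ℝ) (hFx : Fx = ax • u) (hFy : Fy = ay • u)
    (udot : Fin n → ℝ)
    (hudot : udot = -(Dx.mulVec Fx + Dy.mulVec Fy) -
      ((M + Q)⁻¹ * Lᵀ * W).mulVec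
        (fnum - Nx.mulVec (L.mulVec Fx) - Ny.mulVec (L.mulVec Fy))) :
    2 * (u ⬝ᵥ (M + Q).mulVec udot) =
      -2 * ax * (u ⬝ᵥ (Q * Dx).mulVec u) - 2 * ay * (u ⬝ᵥ (Q * Dy).mulVec u) +
      u ⬝ᵥ (Lᵀ * W).mulVec
        (Nx.mulVec (L.mulVec Fx) + Ny.mulVec (L.mulVec Fy) - (2 : ℝ) • fnum) := by
  have hx := two_mul_dotProduct_mulVec_of_sbp hM hSBPx u
  have hy := two_mul_dotProduct_mulVec_of_sbp hM hSBPy u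
  have hinv : (M + Q) * ((M + Q)⁻¹ * Lᵀ * W) = Lᵀ * W := by
    rw [Matrix.mul_assoc (M + Q)⁻¹, mul_nonsing_inv_cancel_left _ _ hMQinv]
  subst hudot hFx hFy
  rw [mulVec_sub, mulVec_mulVec, hinv]
  simp only [mulVec_neg, mulVec_add, mulVec_sub, mulVec_smul, mulVec_mulVec, add_mul, add_mulVec,
    dotProduct_add, dotProduct_sub, dotProduct_neg, dotProduct_smul, smul_eq_mul,
    ← Matrix.mul_assoc] at hx hy ⊢
  linear_combination -ax * hx - ay * hy
end

section
/- Suppose M, Dx, Dy, L, W, Nx, Ny satisfy the SBP property, that Dx·𝟙 = 0 and Dy·𝟙 = 0 where 𝟙 ∈ ℝⁿ is the all-ones vector, and that the correction matrix C (an n×m matrix) satisfies 𝟙ᵀ·M·C = 𝟙ᵀ·Lᵀ·W. Then for every Fx, Fy ∈ ℝⁿ and fnum ∈ ℝᵐ, the FR residual u̇ = −(Dx·Fx + Dy·Fy) − C·(fnum − Nx·L·Fx − Ny·L·Fy) satisfies 𝟙ᵀ·M·u̇ = −𝟙ᵀ·Lᵀ·W·fnum; that is, the rate of change of the discrete total mass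 equals the net numerical flux through the element boundary, so the scheme is conservative. -/
open Matrix

/-- If `v` lies in the kernel of `D`, then the summation-by-parts property `M D + Dᵀ M = B`
reduces to `vᵀ M D = vᵀ B`. -/
theorem vecMul_mul_eq_of_mulVec_eq_zero {ι R : Type*} [Fintype ι] [CommRing R]
    {M D B : Matrix ι ι R} {v : ι → R}
    (hSBP : M * D + Dᵀ * M = B) (hD : D *ᵥ v = 0) : v ᵥ* (M * D) = v ᵥ* B := by
  rw [← hSBP, vecMul_add, ← vecMul_vecMul v Dᵀ, vecMul_transpose, hD, zero_vecMul, add_zero]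

/-- Linear conservation. If the differentiation operators
annihilate constants and the correction matrix satisfies `𝟙ᵀMC = 𝟙ᵀLᵀW`, then
the rate of change of the discrete total mass equals the net numerical flux
through the element boundary. -/
theorem fr_conservation {n m : ℕ}
    (M Dx Dy : Matrix (Fin n) (Fin n) ℝ)
    (L : Matrix (Fin m) (Fin n) ℝ)
    (W Nx Ny : Matrix (Fin m) (Fin m) ℝ)
    (hM : M.IsSymm) (hW : W.IsDiag) (hNx : Nx.IsDiag) (hNy : Ny.IsDiag)
    (hSBPx : M * Dx + Dxᵀ * M = Lᵀ * W * Nx * L)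
    (hSBPy : M * Dy + Dyᵀ * M = Lᵀ * W * Ny * L)
    (hDx1 : Dx.mulVec (fun _ => (1 : ℝ)) = 0)
    (hDy1 : Dy.mulVec (fun _ => (1 : ℝ)) = 0)
    (C : Matrix (Fin n) (Fin m) ℝ)
    (hC : vecMul (fun _ => (1 : ℝ)) (M * C) = vecMul (fun _ => (1 : ℝ)) (Lᵀ * W))
    (Fx Fy : Fin n → ℝ) (fnum : Fin m → ℝ)
    (udot : Fin n → ℝ)
    (hudot : udot = -(Dx.mulVec Fx + Dy.mulVec Fy) -
      C.mulVec (fnum - Nx.mulVec (L.mulVec Fx) - Ny.mulVec (L.mulVec Fy))) :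
    (fun _ => (1 : ℝ)) ⬝ᵥ M.mulVec udot =
      -((fun _ => (1 : ℝ)) ⬝ᵥ (Lᵀ * W).mulVec fnum) := by
  have hx := vecMul_mul_eq_of_mulVec_eq_zero hSBPx hDx1
  have hy := vecMul_mul_eq_of_mulVec_eq_zero hSBPy hDy1
  subst hudot
  simp only [mulVec_sub, mulVec_neg, mulVec_add, dotProduct_sub, dotProduct_neg, dotProduct_add,
    mulVec_mulVec]
  simp only [dotProduct_mulVec, ← Matrix.mul_assoc] at hx hy hC ⊢
  have hCmul (k : ℕ) (A : Matrix (Fin m) (Fin k) ℝ) :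
      (fun _ => (1 : ℝ)) ᵥ* (M * C * A) = (fun _ => (1 : ℝ)) ᵥ* (Lᵀ * W * A) := by
    rw [← vecMul_vecMul, hC, vecMul_vecMul]
  rw [Matrix.mul_assoc (M * C) Nx, Matrix.mul_assoc (M * C) Ny, hCmul, hCmul, hC, hx, hy]
  simp only [← Matrix.mul_assoc]
  ring
end

section
/- Suppose M, Dx, Dy, L, W, Nx, Ny satisfy the SBP property, that Dx·𝟙 = 0 and Dy·𝟙 = 0 where 𝟙 ∈ ℝⁿ is the all-ones vector, that Q is a symmetric n×n matrix with M + Q invertible, and that the extended-range correction matrix C = (M+Q)⁻¹·Lᵀ·W additionally satisfies 𝟙ᵀ·M·(M+Q)⁻¹·Lᵀ·W = 𝟙ᵀ·Lᵀ·W. Then for every Fx, Fy ∈ ℝⁿ and fnum ∈ ℝᵐ, the FR residual u̇ = −(Dx·Fx + Dy·Fy) − C·(fnum − Nx·L·Fx − Ny·L·Fy) satisfies 𝟙ᵀ·M·u̇ = −𝟙ᵀ·Lᵀ·W·fnum, i.e. the extended-range scheme is conservative. -/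
open Matrix

/-- If `v` is in the kernel of `D`, then the row vector `v` does not see the transposed part of
a summation-by-parts identity for `D`. -/
theorem dotProduct_mulVec_mulVec_of_sbp {R ι : Type*} [CommRing R] [Fintype ι]
    {M D B : Matrix ι ι R} {v : ι → R}
    (hSBP : M * D + Dᵀ * M = B) (hD : D *ᵥ v = 0) (F : ι → R) :
    v ⬝ᵥ M *ᵥ D *ᵥ F = v ⬝ᵥ B *ᵥ F := by
  rw [← hSBP, add_mulVec, dotProduct_add, ← mulVec_mulVec F Dᵀ M, dotProduct_mulVec v Dᵀ,
    vecMul_transpose, hD, zero_dotProduct, add_zero, mulVec_mulVec]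

/-- Conservation of the extended-range schemes. For
`C = (M+Q)⁻¹ Lᵀ W` with `Q` symmetric, `M + Q` invertible, and
`𝟙ᵀM(M+Q)⁻¹LᵀW = 𝟙ᵀLᵀW`, the FR scheme is conservative. -/
theorem fr_extended_conservation {n m : ℕ}
    (M Dx Dy : Matrix (Fin n) (Fin n) ℝ)
    (L : Matrix (Fin m) (Fin n) ℝ)
    (W Nx Ny : Matrix (Fin m) (Fin m) ℝ)
    (hM : M.IsSymm) (hW : W.IsDiag) (hNx : Nx.IsDiag) (hNy : Ny.IsDiag)
    (hSBPx : M * Dx + Dxᵀ * M = Lᵀ * W * Nx * L)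
    (hSBPy : M * Dy + Dyᵀ * M = Lᵀ * W * Ny * L)
    (hDx1 : Dx.mulVec (fun _ => (1 : ℝ)) = 0)
    (hDy1 : Dy.mulVec (fun _ => (1 : ℝ)) = 0)
    (Q : Matrix (Fin n) (Fin n) ℝ) (hQ : Q.IsSymm)
    (hMQinv : IsUnit (M + Q).det)
    (hC : vecMul (fun _ => (1 : ℝ)) (M * ((M + Q)⁻¹ * Lᵀ * W)) =
          vecMul (fun _ => (1 : ℝ)) (Lᵀ * W))
    (Fx Fy : Fin n → ℝ) (fnum : Fin m → ℝ)
    (udot : Fin n → ℝ)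
    (hudot : udot = -(Dx.mulVec Fx + Dy.mulVec Fy) -
      ((M + Q)⁻¹ * Lᵀ * W).mulVec
        (fnum - Nx.mulVec (L.mulVec Fx) - Ny.mulVec (L.mulVec Fy))) :
    (fun _ => (1 : ℝ)) ⬝ᵥ M.mulVec udot =
      -((fun _ => (1 : ℝ)) ⬝ᵥ (Lᵀ * W).mulVec fnum) := by
  have hx := dotProduct_mulVec_mulVec_of_sbp hSBPx hDx1 Fx
  have hy := dotProduct_mulVec_mulVec_of_sbp hSBPy hDy1 Fy
  have hcorr (g : Fin m → ℝ) : (fun _ => (1 : ℝ)) ⬝ᵥ M *ᵥ ((M + Q)⁻¹ * Lᵀ * W) *ᵥ g =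
      (fun _ => (1 : ℝ)) ⬝ᵥ (Lᵀ * W) *ᵥ g := by
    rw [mulVec_mulVec, dotProduct_mulVec, hC, ← dotProduct_mulVec]
  rw [hudot, mulVec_sub, mulVec_neg, mulVec_add, dotProduct_sub, dotProduct_neg, dotProduct_add,
    hx, hy, hcorr]
  simp only [mulVec_sub, dotProduct_sub, mulVec_mulVec, Matrix.mul_assoc]
  ring
end

section
/- Let q₀, q₁ ∈ ℝ and let Q̃ be the 6×6 real symmetric matrix (1-based indexing) whose only nonzero entries are Q̃₃₃ = (5q₀ − q₁)/4, Q̃₅₅ = q₁, Q̃₆₆ = q₀, and Q̃₃₆ = Q̃₆₃ = (q₀ − q₁)·√5/2. Then I + Q̃ (with I the 6×6 identity) is positive definite if and only if q₁ > −1 and 9q₀ − 5q₁ > −4. -/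
open Matrix

/-- Spectral decomposition of the quadratic form of `I + Q̃`. -/
lemma dotProduct_one_add_mulVec_eq_sum_sq (q0 q1 : ℝ) (v : Fin 6 → ℝ) :
    v ⬝ᵥ (1 + !![0, 0, 0, 0, 0, 0;
                 0, 0, 0, 0, 0, 0;
                 0, 0, (5 * q0 - q1) / 4, 0, 0, (q0 - q1) * Real.sqrt 5 / 2;
                 0, 0, 0, 0, 0, 0;
                 0, 0, 0, 0, q1, 0;
                 0, 0, (q0 - q1) * Real.sqrt 5 / 2, 0, 0, q0]).mulVec v =
      v 0 ^ 2 + v 1 ^ 2 + v 3 ^ 2 + (1 + q1) * v 4 ^ 2 +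
        (1 + q1) * (2 * v 2 - Real.sqrt 5 * v 5) ^ 2 / 9 +
        (4 + 9 * q0 - 5 * q1) * (Real.sqrt 5 * v 2 + 2 * v 5) ^ 2 / 36 := by
  have h5 : Real.sqrt 5 ^ 2 = 5 := Real.sq_sqrt (by norm_num)
  rw [add_mulVec, one_mulVec, dotProduct_add]
  simp [dotProduct, mulVec, Fin.sum_univ_succ]
  linear_combination (-(1 + q1) * v 5 ^ 2 / 9 - (4 + 9 * q0 - 5 * q1) * v 2 ^ 2 / 36) * h5

/-- Stability conditions for the k = 2 extended-range FR scheme on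
triangles: `I + Q̃` is positive definite iff `q₁ > −1` and `9q₀ − 5q₁ > −4`. -/
theorem k2_triangle_stability (q0 q1 : ℝ)
    (Qt : Matrix (Fin 6) (Fin 6) ℝ)
    (hQt : Qt = !![0, 0, 0, 0, 0, 0;
                   0, 0, 0, 0, 0, 0;
                   0, 0, (5 * q0 - q1) / 4, 0, 0, (q0 - q1) * Real.sqrt 5 / 2;
                   0, 0, 0, 0, 0, 0;
                   0, 0, 0, 0, q1, 0;
                   0, 0, (q0 - q1) * Real.sqrt 5 / 2, 0, 0, q0]) :
    (∀ v : Fin 6 → ℝ, v ≠ 0 → 0 < v ⬝ᵥ (1 + Qt).mulVec v) ↔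
      (q1 > -1 ∧ 9 * q0 - 5 * q1 > -4) := by
  have h5 : Real.sqrt 5 ^ 2 = 5 := Real.sq_sqrt (by norm_num)
  subst hQt
  simp only [dotProduct_one_add_mulVec_eq_sum_sq]
  constructor
  · intro h
    have h4 := h ![0, 0, 0, 0, 1, 0] fun e => by simpa using congrFun e 4
    have h25 := h ![0, 0, Real.sqrt 5, 0, 0, 2] fun e => by simpa using congrFun e 5
    simp at h4 h25
    constructor <;> nlinarith
  · rintro ⟨h1, h2⟩ v hv
    have p1 : 0 < 1 + q1 := by linarith
    have p2 : 0 < 4 + 9 * q0 - 5 * q1 := by linarith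
    refine lt_of_le_of_ne (by positivity) fun e => hv ?_
    have n0 := sq_nonneg (v 0)
    have n1 := sq_nonneg (v 1)
    have n3 := sq_nonneg (v 3)
    have n4 := mul_nonneg p1.le (sq_nonneg (v 4))
    have nx := mul_nonneg p1.le (sq_nonneg (2 * v 2 - Real.sqrt 5 * v 5))
    have ny := mul_nonneg p2.le (sq_nonneg (Real.sqrt 5 * v 2 + 2 * v 5))
    have e0 : v 0 = 0 := pow_eq_zero_iff two_ne_zero |>.1 (by linarith)
    have e1 : v 1 = 0 := pow_eq_zero_iff two_ne_zero |>.1 (by linarith)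
    have e3 : v 3 = 0 := pow_eq_zero_iff two_ne_zero |>.1 (by linarith)
    have e4 : v 4 = 0 := pow_eq_zero_iff two_ne_zero |>.1 <|
      (mul_eq_zero.1 (by linarith : (1 + q1) * v 4 ^ 2 = 0)).resolve_left p1.ne'
    have ex : 2 * v 2 - Real.sqrt 5 * v 5 = 0 := pow_eq_zero_iff two_ne_zero |>.1 <|
      (mul_eq_zero.1 (by linarith :
        (1 + q1) * (2 * v 2 - Real.sqrt 5 * v 5) ^ 2 = 0)).resolve_left p1.ne'
    have ey : Real.sqrt 5 * v 2 + 2 * v 5 = 0 := pow_eq_zero_iff two_ne_zero |>.1 <|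
      (mul_eq_zero.1 (by linarith :
        (4 + 9 * q0 - 5 * q1) * (Real.sqrt 5 * v 2 + 2 * v 5) ^ 2 = 0)).resolve_left p2.ne'
    have e2 : v 2 = 0 := by
      linear_combination (2 / 9) * ex + (Real.sqrt 5 / 9) * ey - v 2 / 9 * h5
    have e5 : v 5 = 0 := by
      linear_combination (2 / 9) * ey - (Real.sqrt 5 / 9) * ex - v 5 / 9 * h5
    ext i
    fin_cases i <;> assumption
end

section
/- Let c ∈ ℝ, set q₀ = 410c/3 and q₁ = 150c, and let Q̃ be the 6×6 real symmetric matrix (1-based indexing) whose only nonzero entries are Q̃₃₃ = (5q₀ − q₁)/4, Q̃₅₅ = q₁, Q̃₆₆ = q₀, and Q̃₃₆ = Q̃₆₃ = (q₀ − q₁)·√5/2. Then I + Q̃ is positive definite if and only if c > −1/150. Hence the single-parameter Castonguay et al. family at k = 2 lies in the extended range of stable FR schemes on triangles exactly for c > −1/150. -/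
open Matrix

/-- The single-parameter Castonguay et al. family at k = 2
(`q₀ = 410c/3`, `q₁ = 150c`) is in the extended range of stable FR schemes on
triangles exactly for `c > −1/150`. -/
theorem k2_castonguay_stability (c q0 q1 : ℝ)
    (hq0 : q0 = 410 * c / 3) (hq1 : q1 = 150 * c)
    (Qt : Matrix (Fin 6) (Fin 6) ℝ)
    (hQt : Qt = !![0, 0, 0, 0, 0, 0;
                   0, 0, 0, 0, 0, 0;
                   0, 0, (5 * q0 - q1) / 4, 0, 0, (q0 - q1) * Real.sqrt 5 / 2;
                   0, 0, 0, 0, 0, 0;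
                   0, 0, 0, 0, q1, 0;
                   0, 0, (q0 - q1) * Real.sqrt 5 / 2, 0, 0, q0]) :
    (∀ v : Fin 6 → ℝ, v ≠ 0 → 0 < v ⬝ᵥ (1 + Qt).mulVec v) ↔ c > -(1 / 150) := by
  have h5 : Real.sqrt 5 ^ 2 = 5 := Real.sq_sqrt (by norm_num)
  have form (v : Fin 6 → ℝ) : v ⬝ᵥ (1 + Qt).mulVec v =
      v 0 ^ 2 + v 1 ^ 2 + v 3 ^ 2 + (1 + 150 * c) * v 4 ^ 2
        + (1 + 150 * c) * ((2 * v 2 - Real.sqrt 5 * v 5) ^ 2 / 9)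
        + (1 + 120 * c) * ((Real.sqrt 5 * v 2 + 2 * v 5) ^ 2 / 9) := by
    subst hQt hq0 hq1
    rw [Matrix.add_mulVec, Matrix.one_mulVec]
    simp [dotProduct, Fin.sum_univ_succ]
    linear_combination (-(1 + 150 * c) * v 5 ^ 2 / 9 - (1 + 120 * c) * v 2 ^ 2 / 9) * h5
  have norm_form (v : Fin 6 → ℝ) : v ⬝ᵥ v =
      v 0 ^ 2 + v 1 ^ 2 + v 3 ^ 2 + v 4 ^ 2
        + (2 * v 2 - Real.sqrt 5 * v 5) ^ 2 / 9
        + (Real.sqrt 5 * v 2 + 2 * v 5) ^ 2 / 9 := by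
    simp only [dotProduct, Fin.sum_univ_six]
    linear_combination (-v 5 ^ 2 / 9 - v 2 ^ 2 / 9) * h5
  constructor
  · intro h
    have h4 := h (Pi.single 4 1) (by simp)
    rw [form] at h4
    simp at h4
    linarith
  · intro hc v hv
    have hpos : 0 < v ⬝ᵥ v := by
      obtain ⟨i, hi⟩ := Function.ne_iff.mp hv
      exact Finset.sum_pos' (fun j _ => mul_self_nonneg (v j))
        ⟨i, Finset.mem_univ i, mul_self_pos.mpr hi⟩
    have hform := form v
    have hnorm := norm_form v
    set a := (2 * v 2 - Real.sqrt 5 * v 5) ^ 2 / 9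
    set b := (Real.sqrt 5 * v 2 + 2 * v 5) ^ 2 / 9
    have ha : 0 ≤ a := by positivity
    have hb : 0 ≤ b := by positivity
    rcases le_total 0 c with h0 | h0
    · have : 0 ≤ c * (150 * v 4 ^ 2 + 150 * a + 120 * b) := by positivity
      linarith
    · have hle : 0 ≤ -c * (150 * (v 0 ^ 2 + v 1 ^ 2 + v 3 ^ 2) + 30 * b) :=
        mul_nonneg (by linarith) (by positivity)
      have hlt : 0 < (1 + 150 * c) * (v ⬝ᵥ v) := mul_pos (by linarith) hpos
      rw [hnorm] at hlt
      linarith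
end

section
/- Let c ∈ ℝ, set q₀ = 6384c, q₁ = 27440c/3, q₂ = −168·√21·c, and let Q̃ be the 8×8 real symmetric matrix (1-based indexing) whose only nonzero entries are Q̃₂₂ = (q₁ + 4q₀)/5 + q₂·√(48/175), Q̃₂₇ = Q̃₇₂ = (q₀ − q₁)/√5 + q₂·√(3/35), Q̃₅₅ = q₀ − q₂·√(16/21), Q̃₅₈ = Q̃₈₅ = q₂, Q̃₇₇ = q₁, and Q̃₈₈ = q₀. Then I + Q̃ (with I the 8×8 identity) is positive definite if and only if c > −1/9800. Hence the single-parameter Castonguay et al. family at k = 3 lies in the extended range of stable FR schemes on triangles exactly for c > −1/9800. -/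
open Matrix

theorem sqrt_twenty_one_mul_sqrt {a b : ℝ} (hb : 0 ≤ b) (h : 21 * a = b ^ 2) :
    √21 * √a = b := by
  rw [← Real.sqrt_mul (by norm_num), h, Real.sqrt_sq hb]

/-- The entries of the Castonguay filter matrix, after simplification of the surds. -/
theorem castonguay_entries (c : ℝ) :
    ((27440 * c / 3 + 4 * (6384 * c)) / 5 + -168 * √21 * c * √(48 / 175) = 19600 / 3 * c) ∧
    ((6384 * c - 27440 * c / 3) / √5 + -168 * √21 * c * √(3 / 35) = -(1960 / 3) * √5 * c) ∧
    (6384 * c - -168 * √21 * c * √(16 / 21) = 7056 * c) := by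
  have h5 : √5 ^ 2 = 5 := Real.sq_sqrt (by norm_num)
  have h5inv : (√5)⁻¹ = √5 / 5 := by
    rw [inv_eq_iff_eq_inv, inv_div, eq_div_iff (by positivity), ← sq, h5]
  have h1 : √21 * √(48 / 175) = 12 / 5 := sqrt_twenty_one_mul_sqrt (by norm_num) (by norm_num)
  have h2 : √21 * √(3 / 35) = 3 * √5 / 5 :=
    sqrt_twenty_one_mul_sqrt (by positivity) (by rw [div_pow, mul_pow, h5]; norm_num)
  have h3 : √21 * √(16 / 21) = 4 := sqrt_twenty_one_mul_sqrt (by norm_num) (by norm_num)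
  refine ⟨?_, ?_, ?_⟩
  · linear_combination (-168 * c) * h1
  · rw [div_eq_mul_inv, h5inv]
    linear_combination (-168 * c) * h2
  · linear_combination (168 * c) * h3

/-- The single-parameter Castonguay et al. family at k = 3
(`q₀ = 6384c`, `q₁ = 27440c/3`, `q₂ = −168√21·c`) is in the extended range of
stable FR schemes on triangles exactly for `c > −1/9800`. -/
theorem k3_castonguay_stability (c q0 q1 q2 : ℝ)
    (hq0 : q0 = 6384 * c) (hq1 : q1 = 27440 * c / 3)
    (hq2 : q2 = -168 * Real.sqrt 21 * c)
    (Qt : Matrix (Fin 8) (Fin 8) ℝ)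
    (hQt : Qt =
      !![0, 0, 0, 0, 0, 0, 0, 0;
         0, (q1 + 4 * q0) / 5 + q2 * Real.sqrt (48 / 175), 0, 0, 0, 0,
            (q0 - q1) / Real.sqrt 5 + q2 * Real.sqrt (3 / 35), 0;
         0, 0, 0, 0, 0, 0, 0, 0;
         0, 0, 0, 0, 0, 0, 0, 0;
         0, 0, 0, 0, q0 - q2 * Real.sqrt (16 / 21), 0, 0, q2;
         0, 0, 0, 0, 0, 0, 0, 0;
         0, (q0 - q1) / Real.sqrt 5 + q2 * Real.sqrt (3 / 35), 0, 0, 0, 0, q1, 0;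
         0, 0, 0, 0, q2, 0, 0, q0]) :
    (∀ v : Fin 8 → ℝ, v ≠ 0 → 0 < v ⬝ᵥ (1 + Qt).mulVec v) ↔ c > -(1 / 9800) := by
  obtain ⟨h22, h27, h55⟩ := castonguay_entries c
  have h5 : √5 ^ 2 = 5 := Real.sq_sqrt (by norm_num)
  have h21 : √21 ^ 2 = 21 := Real.sq_sqrt (by norm_num)
  subst hq0 hq1 hq2
  rw [h22, h27, h55] at hQt
  have spectral (v : Fin 8 → ℝ) : v ⬝ᵥ (1 + Qt).mulVec v = v ⬝ᵥ v +
      c * (9800 / 6 * (v 1 - √5 * v 6) ^ 2 + 5880 / 6 * (√5 * v 1 + v 6) ^ 2 +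
        7560 / 30 * (√21 * v 4 - 3 * v 7) ^ 2 + 5880 / 30 * (3 * v 4 + √21 * v 7) ^ 2) := by
    rw [add_mulVec, one_mulVec, dotProduct_add, hQt]
    simp [dotProduct, mulVec, Fin.sum_univ_eight]
    linear_combination (-c * (9800 / 6 * v 6 ^ 2 + 5880 / 6 * v 1 ^ 2)) * h5 -
      c * (7560 / 30 * v 4 ^ 2 + 5880 / 30 * v 7 ^ 2) * h21
  constructor
  · intro h
    have hv := h ![0, 1, 0, 0, 0, 0, -√5, 0] fun h0 => by simpa using congrFun h0 1
    rw [spectral] at hv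
    simp [dotProduct, Fin.sum_univ_eight] at hv
    ring_nf at hv
    linarith
  · intro hc v hv
    have hpos : 0 < v ⬝ᵥ v := by
      simpa using dotProduct_star_self_pos_iff.mpr hv
    rw [spectral]
    rcases le_or_gt 0 c with h0 | h0
    · positivity
    · have hle : 9800 / 6 * (v 1 - √5 * v 6) ^ 2 + 5880 / 6 * (√5 * v 1 + v 6) ^ 2 +
          7560 / 30 * (√21 * v 4 - 3 * v 7) ^ 2 + 5880 / 30 * (3 * v 4 + √21 * v 7) ^ 2 ≤
          9800 * (v ⬝ᵥ v) := by
        simp only [dotProduct, Fin.sum_univ_eight]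
        have hs5 : (v 1 - √5 * v 6) ^ 2 + (√5 * v 1 + v 6) ^ 2 = 6 * (v 1 ^ 2 + v 6 ^ 2) := by
          linear_combination (v 1 ^ 2 + v 6 ^ 2) * h5
        have hs21 : (√21 * v 4 - 3 * v 7) ^ 2 + (3 * v 4 + √21 * v 7) ^ 2 =
            30 * (v 4 ^ 2 + v 7 ^ 2) := by
          linear_combination (v 4 ^ 2 + v 7 ^ 2) * h21
        linarith [sq_nonneg (v 0), sq_nonneg (v 2), sq_nonneg (v 3), sq_nonneg (v 5),
          sq_nonneg (√5 * v 1 + v 6), sq_nonneg (√21 * v 4 - 3 * v 7),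
          sq_nonneg (3 * v 4 + √21 * v 7)]
      linarith [mul_le_mul_of_nonpos_left hle h0.le,
        mul_pos (show 0 < 1 + 9800 * c by linarith) hpos]
end

section
/- Let z₁, z₂ ∈ ℝ with 0 < z₁ < z₂ < 1, and define q₁ = (525·(z₁² + z₂²)·z₁²·z₂² − 175·(z₁⁴ + z₂⁴) − 105·(z₁² + z₂²) − 560·z₁²·z₂² + 198)/336 and q₄ = (15·z₁²·z₂² − 5·(z₁² + z₂²) + 3)/12. Then q₁ = 0 and q₄ = 0 if and only if z₁² = 3/7 − (2/7)·√(6/5) and z₂² = 3/7 + (2/7)·√(6/5). Hence the unique symmetric interior flux point placement at k = 4 compatible with the extended-range FR stability conditions is the Gauss–Legendre placement. -/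
/-- For the k = 4 one-dimensional spectral difference scheme with
symmetric interior flux points `±z₁, ±z₂` (0 < z₁ < z₂ < 1), the couplings
`q₁` and `q₄` vanish iff `z₁² = 3/7 − (2/7)√(6/5)` and `z₂² = 3/7 + (2/7)√(6/5)`,
i.e. exactly at the Gauss–Legendre placement. -/
theorem sd_1d_k4_gauss_legendre
    (z1 z2 : ℝ) (h1 : 0 < z1) (h12 : z1 < z2) (h2 : z2 < 1)
    (q1 q4 : ℝ)
    (hq1 : q1 = (525 * (z1 ^ 2 + z2 ^ 2) * z1 ^ 2 * z2 ^ 2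
        - 175 * (z1 ^ 4 + z2 ^ 4) - 105 * (z1 ^ 2 + z2 ^ 2)
        - 560 * z1 ^ 2 * z2 ^ 2 + 198) / 336)
    (hq4 : q4 = (15 * z1 ^ 2 * z2 ^ 2 - 5 * (z1 ^ 2 + z2 ^ 2) + 3) / 12) :
    (q1 = 0 ∧ q4 = 0) ↔
      (z1 ^ 2 = 3 / 7 - (2 / 7) * Real.sqrt (6 / 5) ∧
       z2 ^ 2 = 3 / 7 + (2 / 7) * Real.sqrt (6 / 5)) := by
  set r := Real.sqrt (6 / 5)
  have hr0 : 0 ≤ r := Real.sqrt_nonneg _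
  have hr2 : r ^ 2 = 6 / 5 := Real.sq_sqrt (by norm_num)
  have hlt : z1 ^ 2 < z2 ^ 2 := by gcongr
  have hz1 : z1 ^ 4 = (z1 ^ 2) ^ 2 := by ring
  have hz2 : z2 ^ 4 = (z2 ^ 2) ^ 2 := by ring
  rw [hq1, hq4, hz1, hz2]
  generalize z1 ^ 2 = a at *
  generalize z2 ^ 2 = b at *
  constructor
  · rintro ⟨e1, e4⟩
    have hsum : a + b = 6 / 7 := by
      linear_combination (-6 / 5) * e1 + (3 / 2 * (a + b) - 3 / 5) * e4
    have hprod : a * b = 3 / 35 := by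
      linear_combination (4 / 5) * e4 + (1 / 3) * hsum
    have hdiff : b - a = 4 / 7 * r := by
      refine (sq_eq_sq₀ (by linarith) (by positivity)).mp ?_
      linear_combination (a + b + 6 / 7) * hsum - 4 * hprod - 16 / 49 * hr2
    constructor <;> linarith
  · rintro ⟨rfl, rfl⟩
    have hprod : (3 / 7 - 2 / 7 * r) * (3 / 7 + 2 / 7 * r) = 3 / 35 := by
      linear_combination -4 / 49 * hr2
    constructor
    · linear_combination 5 / 7 * hprod
    · linear_combination 15 / 12 * hprod
end
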